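/- The Dodgson/forest identity for three marked vertices: for any three vertices u, v, w of a connected graph G, Φ^{{u,v,w}}_G · Φ^{{u},{v},{w}}_G = Φ^{{u,v},{w}}_G · Φ^{{u,w},{v}}_G + Φ^{{u,v},{w}}_G · Φ^{{u},{v,w}}_G + Φ^{{u,w},{v}}_G · Φ^{{u},{v,w}}_G. -/

import Mathlib

/-- A finite multigraph with oriented edges: each edge has a source and a target vertex.
Self-loops (src = tgt) and parallel edges are allowed. -/
structure Multigraph (E V : Type*) where
  src : E → V
  tgt : E → V

namespace Multigraph

variable {E V : Type*}

/-- Two vertices are adjacent via an edge of the subset `F`. -/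
def Adj (G : Multigraph E V) (F : Finset E) (a b : V) : Prop :=
  ∃ e ∈ F, (G.src e = a ∧ G.tgt e = b) ∨ (G.src e = b ∧ G.tgt e = a)

/-- Reachability (connectivity) using only edges in `F`. -/
def Reach (G : Multigraph E V) (F : Finset E) : V → V → Prop :=
  Relation.ReflTransGen (G.Adj F)

/-- `T` is (the edge set of) a spanning tree of `G`: it connects all vertices and has
`|V| - 1` edges. -/
def IsSpanningTree (G : Multigraph E V) [Fintype V] (T : Finset E) : Prop :=
  (∀ v w : V, G.Reach T v w) ∧ T.card + 1 = Fintype.card V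

/-- `G` is connected. -/
def Connected (G : Multigraph E V) [Fintype E] [Fintype V] : Prop :=
  ∀ v w : V, G.Reach Finset.univ v w

/-- The signed incidence matrix entry of edge `e` at vertex `v`:
`+1` if `e` begins at `v`, `-1` if `e` ends at `v`, `0` otherwise (in particular `0`
for self-loops). -/
def inc (G : Multigraph E V) (R : Type*) [Ring R] [DecidableEq V] (e : E) (v : V) : R :=
  (if G.src e = v then 1 else 0) - (if G.tgt e = v then 1 else 0)

open Classical in
/-- The Kirchhoff (graph) polynomial `Ψ_G = Σ_T Π_{e ∉ T} α_e`, sum over spanning trees. -/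
noncomputable def kirchhoff (G : Multigraph E V) [Fintype E] [DecidableEq E] [Fintype V] :
    MvPolynomial E ℚ :=
  ∑ T : Finset E, if G.IsSpanningTree T then ∏ e ∈ Tᶜ, MvPolynomial.X e else 0

/-- `F` is a spanning forest of `G` whose trees realize the partition `parts` of a subset of
the vertices: it has `|V| - |parts|` edges (forcing acyclicity), vertices in the same part
are connected, vertices in different parts are disconnected, and every vertex lies in the
tree of some part. -/
def IsSpanningForest (G : Multigraph E V) [Fintype V] (parts : Finset (Finset V))
    (F : Finset E) : Prop :=
  F.card + parts.card = Fintype.card V ∧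
  (∀ p ∈ parts, ∀ v ∈ p, ∀ w ∈ p, G.Reach F v w) ∧
  (∀ p ∈ parts, ∀ q ∈ parts, p ≠ q → ∀ v ∈ p, ∀ w ∈ q, ¬ G.Reach F v w) ∧
  (∀ v : V, ∃ p ∈ parts, ∃ w ∈ p, G.Reach F v w)

open Classical in
/-- The spanning forest polynomial `Φ^P_G = Σ_F Π_{e ∉ F} α_e`. -/
noncomputable def forestPoly (G : Multigraph E V) [Fintype E] [DecidableEq E] [Fintype V]
    (parts : Finset (Finset V)) : MvPolynomial E ℚ :=
  ∑ F : Finset E, if G.IsSpanningForest parts F then ∏ e ∈ Fᶜ, MvPolynomial.X e else 0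

end Multigraph

/-- `parts` is a set partition (of the union of its parts): parts are nonempty and
pairwise disjoint. -/
def IsSetPartition {V : Type*} (parts : Finset (Finset V)) : Prop :=
  ∅ ∉ parts ∧ ∀ p ∈ parts, ∀ q ∈ parts, p ≠ q → Disjoint p q

/-- `parts` is a set partition of the finite vertex set `W`. -/
def IsPartitionOf {V : Type*} (W : Finset V) (parts : Finset (Finset V)) : Prop :=
  IsSetPartition parts ∧ (∀ p ∈ parts, p ⊆ W) ∧ ∀ v ∈ W, ∃ p ∈ parts, v ∈ p

namespace Matrix

variable {n m R : Type*} [Fintype n] [DecidableEq n] [Fintype m] [CommRing R]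

/-- The determinant of a product of rectangular matrices, expanded along the columns of the
left factor. -/
theorem det_mul_eq_sum_det_submatrix_mul_prod (M : Matrix n m R) (N : Matrix m n R) :
    (M * N).det = ∑ p : n → m, (M.submatrix id p).det * ∏ i, N (p i) i := by
  simp only [det_apply', mul_apply, Finset.prod_univ_sum, Fintype.piFinset_univ, Finset.mul_sum,
    Finset.sum_mul]
  rw [Finset.sum_comm]
  refine Finset.sum_congr rfl fun p _ => Finset.sum_congr rfl fun σ _ => ?_
  simp [Finset.prod_mul_distrib, mul_assoc]

/-- The Cauchy–Binet formula, summed over all maps `n → m` instead of over subsets. -/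
theorem factorial_smul_det_mul (M : Matrix n m R) (N : Matrix m n R) :
    (Fintype.card n).factorial • (M * N).det =
      ∑ p : n → m, (M.submatrix id p).det * (N.submatrix p id).det := by
  have h (τ : Equiv.Perm n) : (M * N).det =
      ∑ p : n → m, (M.submatrix id p).det * (Equiv.Perm.sign τ * ∏ i, N (p (τ i)) i) := by
    rw [det_mul_eq_sum_det_submatrix_mul_prod,
      ← (Equiv.arrowCongr τ (Equiv.refl m)).symm.sum_comp]
    refine Finset.sum_congr rfl fun p _ => ?_
    have hp : M.submatrix id ((Equiv.arrowCongr τ (Equiv.refl m)).symm p) =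
        (M.submatrix id p).submatrix id τ := rfl
    rw [hp, det_permute']
    simp only [Equiv.arrowCongr_symm, Equiv.arrowCongr_apply]
    simp
    ring
  rw [← Fintype.card_perm, ← Finset.card_univ, ← Finset.sum_const, Finset.sum_congr rfl
    fun τ _ => h τ, Finset.sum_comm]
  refine Finset.sum_congr rfl fun p _ => ?_
  rw [← Finset.mul_sum, det_apply' (N.submatrix p id)]
  rfl

end Matrix

theorem Finset.card_filter_injective_image_eq {n m : Type*} [Fintype n] [DecidableEq n]
    [Fintype m] [DecidableEq m] (F : Finset m) (hF : F.card = Fintype.card n) :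
    (Finset.univ.filter fun p : n → m =>
      Function.Injective p ∧ Finset.univ.image p = F).card = (Fintype.card n).factorial := by
  have hc : Fintype.card (n ↪ F) = (Fintype.card n).factorial := by
    rw [Fintype.card_embedding_eq, Fintype.card_coe, hF, Nat.descFactorial_self]
  rw [← hc, ← Finset.card_univ]
  symm
  refine Finset.card_bij (fun q _ i => (q i : m)) ?_ ?_ ?_
  · intro q _
    have hq : Function.Injective fun i => (q i : m) := Subtype.val_injective.comp q.injective
    refine Finset.mem_filter.2 ⟨Finset.mem_univ _, hq, ?_⟩
    refine Finset.eq_of_subset_of_card_le ?_ ?_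
    · simp [Finset.subset_iff]
    · rw [Finset.card_image_of_injective _ hq, hF, Finset.card_univ]
  · intro q _ r _ h
    ext i
    exact congrFun h i
  · intro p hp
    obtain ⟨hi, rfl⟩ := (Finset.mem_filter.1 hp).2
    exact ⟨⟨fun i => ⟨p i, Finset.mem_image_of_mem p (Finset.mem_univ i)⟩,
      fun i j h => hi (congrArg Subtype.val h)⟩, Finset.mem_univ _, rfl⟩

theorem Finset.sum_ite_injective_image {n m R : Type*} [Fintype n] [DecidableEq n]
    [Fintype m] [DecidableEq m] [CommRing R] (g : Finset m → R) :
    (∑ p : n → m, if Function.Injective p then g (Finset.univ.image p) else 0) =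
      (Fintype.card n).factorial • ∑ F : Finset m, if F.card = Fintype.card n then g F else 0 := by
  classical
  rw [← Finset.sum_fiberwise (s := Finset.univ) (g := fun p : n → m => Finset.univ.image p),
    Finset.smul_sum]
  refine Finset.sum_congr rfl fun F _ => ?_
  rw [← Finset.sum_filter, Finset.filter_filter]
  simp only [and_comm (b := Function.Injective _)]
  rw [Finset.sum_congr rfl (g := fun _ => g F)
    fun p hp => by rw [(Finset.mem_filter.1 hp).2.2], Finset.sum_const]
  split_ifs with hF
  · rw [Finset.card_filter_injective_image_eq F hF]
  · rw [Finset.card_eq_zero.2, zero_smul, smul_zero]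
    refine Finset.filter_eq_empty_iff.2 fun p _ hp => hF ?_
    rw [← hp.2, Finset.card_image_of_injective _ hp.1, Finset.card_univ]

namespace Matrix

variable {V T κ K : Type*} [Fintype T] [DecidableEq T] [Fintype κ] [Field K]

/-- The Schur complement, as a matrix on all indices, of the block of `L` selected by `t`. -/
noncomputable def schurResponse (L : Matrix V V K) (t : T → V) : Matrix V V K :=
  L - L.submatrix id t * (L.submatrix t t)⁻¹ * L.submatrix t id

theorem det_submatrix_sumElim [DecidableEq κ] (L : Matrix V V K) (t : T → V) (g : κ → V)
    (h : (L.submatrix t t).det ≠ 0) :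
    (L.submatrix (Sum.elim t g) (Sum.elim t g)).det =
      (L.submatrix t t).det * ((L.schurResponse t).submatrix g g).det := by
  have hb : L.submatrix (Sum.elim t g) (Sum.elim t g) =
      fromBlocks (L.submatrix t t) (L.submatrix t g) (L.submatrix g t) (L.submatrix g g) := by
    ext (i | i) (j | j) <;> rfl
  have : Invertible (L.submatrix t t) := invertibleOfIsUnitDet _ (isUnit_iff_ne_zero.2 h)
  rw [hb, det_fromBlocks₁₁, invOf_eq_nonsing_inv]
  rfl

theorem schurResponse_transpose {L : Matrix V V K} (hL : Lᵀ = L) (t : T → V) :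
    (L.schurResponse t)ᵀ = L.schurResponse t := by
  have h1 : (L.submatrix id t)ᵀ = L.submatrix t id := by rw [transpose_submatrix, hL]
  have h2 : (L.submatrix t id)ᵀ = L.submatrix id t := by rw [transpose_submatrix, hL]
  have h3 : (L.submatrix t t)ᵀ = L.submatrix t t := by rw [transpose_submatrix, hL]
  rw [schurResponse, transpose_sub, transpose_mul, transpose_mul, transpose_nonsing_inv,
    h1, h2, h3, hL, Matrix.mul_assoc]

/-- If the rows of `L` sum to zero over the disjoint union of `t` and `g`, the rows of the
Schur complement sum to zero over `g`. -/
theorem sum_schurResponse_eq_zero {L : Matrix V V K} {t : T → V} {g : κ → V}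
    (h : (L.submatrix t t).det ≠ 0) (hL : ∀ a, ∑ i, L a (t i) + ∑ k, L a (g k) = 0) (a : V) :
    ∑ k, L.schurResponse t a (g k) = 0 := by
  have h1 : L.submatrix t g *ᵥ 1 = -(L.submatrix t t *ᵥ 1) := by
    ext i
    simpa [mulVec, dotProduct] using eq_neg_of_add_eq_zero_right (hL (t i))
  have h2 : (L.schurResponse t).submatrix id g *ᵥ 1 =
      L.submatrix id g *ᵥ 1 - L.submatrix id t *ᵥ ((L.submatrix t t)⁻¹ *ᵥ
        (L.submatrix t g *ᵥ 1)) := by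
    rw [mulVec_mulVec, mulVec_mulVec, ← sub_mulVec]
    rfl
  rw [h1, mulVec_neg, mulVec_mulVec, nonsing_inv_mul _ (isUnit_iff_ne_zero.2 h),
    one_mulVec, mulVec_neg, sub_neg_eq_add] at h2
  have h3 := congrFun h2 a
  have h4 := hL a
  simp only [mulVec, dotProduct, submatrix_apply, id, Pi.one_apply, mul_one, Pi.add_apply] at h3
  rw [h3, add_comm, h4]

/-- For a symmetric matrix with zero row sums on three indices outside a block with
determinant `b`: the principal minors satisfy the relation of the triangle graph. -/
theorem principal_minors_triangle {L : Matrix V V K} (hL : Lᵀ = L) (t : T → V) (u v w : V)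
    (h : (L.submatrix t t).det ≠ 0)
    (hsum : ∀ a, ∑ i, L a (t i) + (L a u + L a v + L a w) = 0) :
    ∃ P Q R : K,
      (L.submatrix (Sum.elim t ![u]) (Sum.elim t ![u])).det = P + Q ∧
      (L.submatrix (Sum.elim t ![v]) (Sum.elim t ![v])).det = P + R ∧
      (L.submatrix (Sum.elim t ![w]) (Sum.elim t ![w])).det = Q + R ∧
      (L.submatrix (Sum.elim t ![u, v]) (Sum.elim t ![u, v])).det * (L.submatrix t t).det =
        P * Q + P * R + Q * R := by
  have hs := sum_schurResponse_eq_zero (g := ![u, v, w]) h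
    (by simpa [Fin.sum_univ_three] using hsum)
  simp only [Fin.sum_univ_three] at hs
  have hu := hs u
  have hv := hs v
  have hw := hs w
  have hsymm (a c : V) : L.schurResponse t a c = L.schurResponse t c a :=
    congrFun (congrFun (schurResponse_transpose hL t) c) a
  simp only [det_submatrix_sumElim _ _ _ h, det_fin_two, det_unique, submatrix_apply]
  simp at hu hv hw
  rw [hsymm v u] at hv
  rw [hsymm w u, hsymm w v] at hw
  refine ⟨-((L.submatrix t t).det * L.schurResponse t u v),
    -((L.submatrix t t).det * L.schurResponse t u w),
    -((L.submatrix t t).det * L.schurResponse t v w), ?_, ?_, ?_, ?_⟩ <;> simp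
  · linear_combination (L.submatrix t t).det * hu
  · linear_combination (L.submatrix t t).det * hv
  · linear_combination (L.submatrix t t).det * hw
  · have hu' : L.schurResponse t u u = -L.schurResponse t u v - L.schurResponse t u w := by
      linear_combination hu
    have hv' : L.schurResponse t v v = -L.schurResponse t u v - L.schurResponse t v w := by
      linear_combination hv
    rw [hsymm v u, hu', hv']
    ring

end Matrix

namespace Multigraph

open scoped Matrix

variable {E V : Type*} {G : Multigraph E V}

theorem Adj.symm {F : Finset E} {a b : V} (h : G.Adj F a b) : G.Adj F b a := by
  obtain ⟨e, he, h⟩ := h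
  exact ⟨e, he, h.symm⟩

theorem Reach.refl (F : Finset E) (a : V) : G.Reach F a a :=
  Relation.ReflTransGen.refl

theorem Reach.symm {F : Finset E} {a b : V} (h : G.Reach F a b) : G.Reach F b a :=
  by
  induction h with
  | refl => exact Relation.ReflTransGen.refl
  | tail _ hbc ih => exact Relation.ReflTransGen.head hbc.symm ih

theorem Reach.trans {F : Finset E} {a b c : V} (h : G.Reach F a b) (h' : G.Reach F b c) :
    G.Reach F a c :=
  Relation.ReflTransGen.trans h h'

theorem Reach.single {F : Finset E} {e : E} (he : e ∈ F) : G.Reach F (G.src e) (G.tgt e) :=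
  Relation.ReflTransGen.single ⟨e, he, Or.inl ⟨rfl, rfl⟩⟩

/-- A function that agrees at the two ends of every edge in `F` is constant on components. -/
theorem Reach.apply_eq {α : Type*} {F : Finset E} {z : V → α}
    (hz : ∀ e ∈ F, z (G.src e) = z (G.tgt e)) {a b : V} (h : G.Reach F a b) : z a = z b := by
  induction h with
  | refl => rfl
  | tail _ hbc ih =>
    obtain ⟨e, he, ⟨rfl, rfl⟩ | ⟨rfl, rfl⟩⟩ := hbc
    · exact ih.trans (hz e he)
    · exact ih.trans (hz e he).symm

/-- `F` is a spanning forest with exactly one root in `S` per tree; acyclicity and the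
separation of the roots are forced by the number of edges. -/
def IsRootedForest (G : Multigraph E V) [Fintype V] (S : Finset V) (F : Finset E) : Prop :=
  F.card + S.card = Fintype.card V ∧ ∀ v, ∃ s ∈ S, G.Reach F v s

section Incidence

variable [DecidableEq V]

theorem single_sub_single_mem_span_inc {F : Finset E} {a b : V} (h : G.Reach F a b) :
    (Pi.single a 1 - Pi.single b 1 : V → ℤ) ∈ Submodule.span ℤ (G.inc ℤ '' F) := by
  have hinc (e : E) :
      (Pi.single (G.src e) 1 - Pi.single (G.tgt e) 1 : V → ℤ) = G.inc ℤ e := by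
    ext v
    simp [inc, Pi.single_apply, eq_comm]
  induction h with
  | refl => simp
  | @tail b c _ hbc ih =>
    rw [← sub_add_sub_cancel _ (Pi.single b 1 : V → ℤ)]
    refine add_mem ih ?_
    obtain ⟨e, he, ⟨rfl, rfl⟩ | ⟨rfl, rfl⟩⟩ := hbc
    · rw [hinc]
      exact Submodule.subset_span ⟨e, he, rfl⟩
    · rw [← neg_sub, hinc]
      exact neg_mem (Submodule.subset_span ⟨e, he, rfl⟩)

variable {n : Type*} [Fintype n]

theorem card_add_card_eq_of_injective [Fintype V] {f : n → V} (hf : Function.Injective f)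
    {S : Finset V} (hS : ∀ v, v ∈ S ↔ v ∉ Set.range f) :
    Fintype.card n + S.card = Fintype.card V := by
  have : S = (Finset.univ.image f)ᶜ := by
    ext v
    simp [hS]
  rw [this, Finset.card_compl, Finset.card_image_of_injective _ hf, Finset.card_univ]
  exact Nat.add_sub_cancel' (Fintype.card_le_of_injective f hf)

/-- The square incidence matrix with rows the vertices `f i` and columns the edges `p j`. -/
def incMinor (G : Multigraph E V) (f : n → V) (p : n → E) : Matrix n n ℤ :=
  Matrix.of fun i j => G.inc ℤ (p j) (f i)

theorem exists_incMinor_mulVec_eq [DecidableEq E] (f : n → V) (p : n → E) {a b : V}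
    (h : G.Reach (Finset.univ.image p) a b) :
    ∃ c : n → ℤ, (∀ v, ∑ j, c j * G.inc ℤ (p j) v =
      (Pi.single a 1 - Pi.single b 1 : V → ℤ) v) ∧
      G.incMinor f p *ᵥ c = fun i => (Pi.single a 1 - Pi.single b 1 : V → ℤ) (f i) := by
  have hspan := single_sub_single_mem_span_inc h
  rw [Finset.coe_image, Finset.coe_univ, Set.image_univ, ← Set.range_comp,
    Submodule.mem_span_range_iff_exists_fun] at hspan
  obtain ⟨c, hc⟩ := hspan
  have hc' (v : V) : ∑ j, c j * G.inc ℤ (p j) v =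
      (Pi.single a 1 - Pi.single b 1 : V → ℤ) v := by
    simpa using congrFun hc v
  refine ⟨c, hc', funext fun i => ?_⟩
  rw [← hc']
  simp [Matrix.mulVec, dotProduct, incMinor, mul_comm]

variable [DecidableEq n]

theorem isUnit_det_incMinor [DecidableEq E] {f : n → V} (hf : Function.Injective f)
    {p : n → E} (h : ∀ v, ∃ s, s ∉ Set.range f ∧ G.Reach (Finset.univ.image p) v s) :
    IsUnit (G.incMinor f p).det := by
  rw [← Matrix.isUnit_iff_isUnit_det, ← Matrix.mulVec_surjective_iff_isUnit]
  have hcol (i : n) : ∃ c, G.incMinor f p *ᵥ c = Pi.single i 1 := by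
    obtain ⟨s, hs, hr⟩ := h (f i)
    obtain ⟨c, -, hc⟩ := exists_incMinor_mulVec_eq f p hr
    refine ⟨c, hc.trans (funext fun j => ?_)⟩
    have hjs : f j ≠ s := fun hj => hs ⟨j, hj⟩
    simp [Pi.single_apply, hjs, hf.eq_iff]
  choose c hc using hcol
  intro y
  refine ⟨∑ i, y i • c i, ?_⟩
  rw [Matrix.mulVec_sum]
  simp only [Matrix.mulVec_smul, hc]
  exact (pi_eq_sum_univ' y).symm

theorem det_incMinor_eq_zero [DecidableEq E] {f : n → V} (hf : Function.Injective f)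
    {p : n → E} (h : ¬ ∀ v, ∃ s, s ∉ Set.range f ∧ G.Reach (Finset.univ.image p) v s) :
    (G.incMinor f p).det = 0 := by
  classical
  push Not at h
  obtain ⟨a, ha⟩ := h
  obtain ⟨i, rfl⟩ : a ∈ Set.range f := by
    by_contra hne
    exact ha a hne (Reach.refl _ a)
  let z : V → ℤ := fun v => if G.Reach (Finset.univ.image p) (f i) v then 1 else 0
  have hz (v : V) (hv : v ∉ Set.range f) : z v = 0 := if_neg (ha v hv)
  rw [← Matrix.exists_vecMul_eq_zero_iff]
  refine ⟨z ∘ f, fun h0 => ?_, funext fun j => ?_⟩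
  · have := congrFun h0 i
    simp [z, Reach.refl] at this
  · have hsum (b : V) : ∑ k, z (f k) * (if b = f k then 1 else 0) = z b := by
      by_cases hb : b ∈ Set.range f
      · obtain ⟨k, rfl⟩ := hb
        simp [hf.eq_iff]
      · rw [hz b hb]
        refine Finset.sum_eq_zero fun k _ => ?_
        rw [if_neg fun hk => hb ⟨k, hk.symm⟩, mul_zero]
    have hr : G.Reach (Finset.univ.image p) (G.src (p j)) (G.tgt (p j)) :=
      Reach.single (Finset.mem_image_of_mem p (Finset.mem_univ j))
    have he : z (G.src (p j)) = z (G.tgt (p j)) :=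
      if_congr ⟨fun h => h.trans hr, fun h => h.trans hr.symm⟩ rfl rfl
    simp only [Matrix.vecMul, dotProduct, incMinor, Matrix.of_apply, inc, Function.comp_apply,
      mul_sub, Finset.sum_sub_distrib, hsum, he, sub_self, Pi.zero_apply]

theorem det_incMinor_eq_zero_of_not_injective (f : n → V) {p : n → E}
    (hp : ¬ Function.Injective p) : (G.incMinor f p).det = 0 := by
  simp only [Function.Injective, not_forall] at hp
  obtain ⟨i, j, hij, hne⟩ := hp
  exact Matrix.det_zero_of_column_eq hne fun k => by simp [incMinor, hij]

open Classical in
theorem det_incMinor_sq [DecidableEq E] {f : n → V} (hf : Function.Injective f) (p : n → E) :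
    (G.incMinor f p).det ^ 2 = if Function.Injective p then
      (if ∀ v, ∃ s, s ∉ Set.range f ∧ G.Reach (Finset.univ.image p) v s then 1 else 0)
      else 0 := by
  split_ifs with hp h
  · exact Int.isUnit_sq (isUnit_det_incMinor hf h)
  · rw [det_incMinor_eq_zero hf h, sq, zero_mul]
  · rw [det_incMinor_eq_zero_of_not_injective f hp, sq, zero_mul]

theorem IsRootedForest.eq_of_reach [DecidableEq E] [Fintype V] {S : Finset V} {F : Finset E}
    (hF : G.IsRootedForest S F) {a b : V} (ha : a ∈ S) (hb : b ∈ S) (h : G.Reach F a b) :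
    a = b := by
  have hcard : Fintype.card {v // v ∉ S} = Fintype.card F := by
    rw [Fintype.card_subtype_compl, Fintype.card_coe, Fintype.card_coe]
    exact Nat.sub_eq_of_eq_add hF.1.symm
  let g := Fintype.equivOfCardEq hcard
  have himage : Finset.univ.image (fun i => (g i : E)) = F := by
    ext e
    simp only [Finset.mem_image, Finset.mem_univ, true_and]
    exact ⟨fun ⟨i, hi⟩ => hi ▸ (g i).2, fun he => ⟨g.symm ⟨e, he⟩, by simp⟩⟩
  have hunit : IsUnit (G.incMinor (Subtype.val : {v // v ∉ S} → V) fun i => (g i : E)).det := by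
    refine isUnit_det_incMinor Subtype.val_injective fun v => ?_
    obtain ⟨s, hs, hr⟩ := hF.2 v
    exact ⟨s, by simpa using hs, himage.symm ▸ hr⟩
  obtain ⟨c, hc, hc'⟩ := exists_incMinor_mulVec_eq (Subtype.val : {v // v ∉ S} → V)
    (fun i => (g i : E)) (himage.symm ▸ h)
  have h0 : c = 0 := by
    refine Matrix.eq_zero_of_mulVec_eq_zero hunit.ne_zero (hc'.trans (funext fun i => ?_))
    have hia : (i : V) ≠ a := fun hi => i.2 (hi ▸ ha)
    have hib : (i : V) ≠ b := fun hi => i.2 (hi ▸ hb)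
    simp [hia, hib]
  by_contra hab
  simpa [h0, hab] using hc a

/-- The Laplacian matrix with edge weights `y`. -/
def laplacian (G : Multigraph E V) [Fintype E] (y : E → ℚ) : Matrix V V ℚ :=
  Matrix.of fun a b => ∑ e, G.inc ℚ e a * (y e * G.inc ℚ e b)

variable [Fintype E]

theorem laplacian_transpose (y : E → ℚ) : (G.laplacian y)ᵀ = G.laplacian y := by
  ext a b
  exact Finset.sum_congr rfl fun e _ => by ring

theorem sum_laplacian [Fintype V] (y : E → ℚ) (a : V) : ∑ b, G.laplacian y a b = 0 := by
  simp only [laplacian, Matrix.of_apply]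
  rw [Finset.sum_comm]
  refine Finset.sum_eq_zero fun e _ => ?_
  rw [← Finset.mul_sum, ← Finset.mul_sum]
  simp [inc]

open Classical in
/-- The weighted matrix-tree theorem for principal minors. -/
theorem det_laplacian_submatrix [DecidableEq E] [Fintype V] (y : E → ℚ) {f : n → V}
    (hf : Function.Injective f) {S : Finset V} (hS : ∀ v, v ∈ S ↔ v ∉ Set.range f) :
    ((G.laplacian y).submatrix f f).det =
      ∑ F : Finset E, if G.IsRootedForest S F then ∏ e ∈ F, y e else 0 := by
  let M : Matrix n E ℚ := Matrix.of fun i e => G.inc ℚ e (f i)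
  let N : Matrix E n ℚ := Matrix.of fun e i => y e * G.inc ℚ e (f i)
  have hMN : (G.laplacian y).submatrix f f = M * N := rfl
  have hM (p : n → E) : (M.submatrix id p).det = (G.incMinor f p).det := by
    have : M.submatrix id p = (G.incMinor f p).map (Int.castRingHom ℚ) := by
      ext i j
      simp [M, incMinor, inc]
    rw [this, ← RingHom.mapMatrix_apply, ← RingHom.map_det]
    rfl
  have hN (p : n → E) : (N.submatrix p id).det = (∏ i, y (p i)) * (G.incMinor f p).det := by
    have : N.submatrix p id = Matrix.of fun i j => y (p i) * (M.submatrix id p)ᵀ i j := rfl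
    rw [this, Matrix.det_mul_column, Matrix.det_transpose, hM]
  let g : Finset E → ℚ := fun F => if ∀ v, ∃ s ∈ S, G.Reach F v s then ∏ e ∈ F, y e else 0
  have key := Matrix.factorial_smul_det_mul M N
  have hterm (p : n → E) : (M.submatrix id p).det * (N.submatrix p id).det =
      if Function.Injective p then
        g (Finset.univ.image p) else 0 := by
    have hsq : ((G.incMinor f p).det : ℚ) ^ 2 = ((G.incMinor f p).det ^ 2 : ℤ) := by
      push_cast
      rfl
    rw [hM, hN, mul_left_comm, ← sq, hsq, det_incMinor_sq hf]
    simp only [g, hS]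
    by_cases hp : Function.Injective p
    · rw [if_pos hp, if_pos hp, Finset.prod_image fun i _ j _ h => hp h]
      split_ifs <;> simp
    · simp [hp]
  rw [Finset.sum_congr rfl fun p _ => hterm p, Finset.sum_ite_injective_image g] at key
  rw [hMN, smul_right_injective ℚ (Nat.factorial_ne_zero _) key]
  refine Finset.sum_congr rfl fun F _ => ?_
  have hc := card_add_card_eq_of_injective hf hS
  rw [← ite_and]
  refine if_congr (and_congr_left fun _ => ?_) rfl rfl
  omega

theorem det_laplacian_submatrix_ne_zero (hconn : ∀ a b, G.Reach Finset.univ a b) {y : E → ℚ}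
    (hy : ∀ e, 0 < y e) {f : n → V} (hf : Function.Injective f) {s : V}
    (hs : s ∉ Set.range f) : ((G.laplacian y).submatrix f f).det ≠ 0 := by
  intro h
  obtain ⟨z, hz, hLz⟩ := Matrix.exists_mulVec_eq_zero_iff.2 h
  let Z : V → ℚ := fun v => ∑ i, (if v = f i then 1 else 0) * z i
  have hZ (i : n) : Z (f i) = z i := by simp [Z, hf.eq_iff]
  have hZs : Z s = 0 := Finset.sum_eq_zero fun i _ => by
    rw [if_neg fun hi => hs ⟨i, hi.symm⟩, zero_mul]
  have hinc (e : E) : ∑ i, G.inc ℚ e (f i) * z i = Z (G.src e) - Z (G.tgt e) := by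
    simp only [inc, sub_mul, Finset.sum_sub_distrib, Z]
  have hquad : z ⬝ᵥ (G.laplacian y).submatrix f f *ᵥ z =
      ∑ e, y e * (Z (G.src e) - Z (G.tgt e)) ^ 2 := by
    let M : Matrix n E ℚ := Matrix.of fun i e => G.inc ℚ e (f i)
    let N : Matrix E n ℚ := Matrix.of fun e i => y e * G.inc ℚ e (f i)
    have hMN : (G.laplacian y).submatrix f f = M * N := rfl
    rw [hMN, ← Matrix.mulVec_mulVec, Matrix.dotProduct_mulVec]
    refine Finset.sum_congr rfl fun e _ => ?_
    have h1 : (z ᵥ* M) e = Z (G.src e) - Z (G.tgt e) := by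
      rw [← hinc]
      exact Finset.sum_congr rfl fun i _ => mul_comm _ _
    have h2 : (N *ᵥ z) e = y e * (Z (G.src e) - Z (G.tgt e)) := by
      rw [← hinc, Finset.mul_sum]
      exact Finset.sum_congr rfl fun i _ => mul_assoc _ _ _
    rw [h1, h2]
    ring
  rw [hLz, dotProduct_zero, eq_comm,
    Finset.sum_eq_zero_iff_of_nonneg fun e _ => mul_nonneg (hy e).le (sq_nonneg _)] at hquad
  refine hz (funext fun i => ?_)
  rw [← hZ, Reach.apply_eq (z := Z) (fun e _ => ?_) (hconn (f i) s), hZs, Pi.zero_apply]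
  have he := (mul_eq_zero.1 (hquad e (Finset.mem_univ e))).resolve_left (hy e).ne'
  exact sub_eq_zero.1 (pow_eq_zero_iff two_ne_zero |>.1 he)

end Incidence

section Partitions

variable [Fintype V] [DecidableEq V]

theorem isSpanningForest_singletons_iff [DecidableEq E] {u v w : V} (huv : u ≠ v) (huw : u ≠ w)
    (hvw : v ≠ w) (F : Finset E) :
    G.IsSpanningForest {({u} : Finset V), {v}, {w}} F ↔ G.IsRootedForest {u, v, w} F := by
  have hparts : ({({u} : Finset V), {v}, {w}} : Finset (Finset V)).card = 3 :=
    Finset.card_eq_three.2 ⟨{u}, {v}, {w}, by simpa, by simpa, by simpa, rfl⟩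
  have hroots : ({u, v, w} : Finset V).card = 3 :=
    Finset.card_eq_three.2 ⟨u, v, w, huv, huw, hvw, rfl⟩
  constructor
  · rintro ⟨hc, -, -, hr⟩
    refine ⟨by omega, fun a => ?_⟩
    simpa using hr a
  · intro h
    refine ⟨by have := h.1; omega, ?_, ?_, fun a => ?_⟩
    · simp [Reach.refl]
    · intro p hp q hq hpq a ha b hb hab
      have hp' : p = {a} ∧ a ∈ ({u, v, w} : Finset V) := by
        simp only [Finset.mem_insert, Finset.mem_singleton] at hp
        rcases hp with rfl | rfl | rfl <;> simp_all
      have hq' : q = {b} ∧ b ∈ ({u, v, w} : Finset V) := by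
        simp only [Finset.mem_insert, Finset.mem_singleton] at hq
        rcases hq with rfl | rfl | rfl <;> simp_all
      exact hpq (by rw [hp'.1, hq'.1, h.eq_of_reach hp'.2 hq'.2 hab])
    · simpa using h.2 a

theorem isSpanningForest_singleton_iff (u v w : V) (F : Finset E) :
    G.IsSpanningForest {({u, v, w} : Finset V)} F ↔ G.IsRootedForest {w} F := by
  constructor
  · rintro ⟨hc, hp, -, hr⟩
    refine ⟨by simpa using hc, fun a => ⟨w, by simp, ?_⟩⟩
    obtain ⟨p, hpm, b, hb, hab⟩ := hr a
    obtain rfl := Finset.mem_singleton.1 hpm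
    exact hab.trans (hp _ hpm b hb w (by simp))
  · rintro ⟨hc, hr⟩
    have hw (a : V) : G.Reach F a w := by simpa using hr a
    refine ⟨by simpa using hc, fun p _ a _ b _ => (hw a).trans (hw b).symm, ?_,
      fun a => ⟨_, Finset.mem_singleton_self _, w, by simp, hw a⟩⟩
    intro p hp q hq hpq
    rw [Finset.mem_singleton] at hp hq
    exact absurd (hp.trans hq.symm) hpq

theorem isSpanningForest_pair_iff [DecidableEq E] {a b c : V} (hac : a ≠ c)
    (F : Finset E) :
    G.IsSpanningForest {({a, b} : Finset V), {c}} F ↔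
      G.IsRootedForest {a, c} F ∧ G.Reach F a b := by
  have hne : ({a, b} : Finset V) ≠ {c} := fun h => by
    have : a ∈ ({c} : Finset V) := h ▸ Finset.mem_insert_self a _
    exact hac (Finset.mem_singleton.1 this)
  have hparts := Finset.card_pair hne
  have hroots := Finset.card_pair hac
  constructor
  · rintro ⟨hc, hp, -, hr⟩
    have hab : G.Reach F a b := hp {a, b} (by simp) a (by simp) b (by simp)
    refine ⟨⟨by omega, fun d => ?_⟩, hab⟩
    have hd : (G.Reach F d a ∨ G.Reach F d b) ∨ G.Reach F d c := by simpa using hr d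
    rcases hd with (h | h) | h
    · exact ⟨a, by simp, h⟩
    · exact ⟨a, by simp, h.trans hab.symm⟩
    · exact ⟨c, by simp, h⟩
  · rintro ⟨h, hab⟩
    have hsep : ¬ G.Reach F a c := fun h' => hac (h.eq_of_reach (by simp) (by simp) h')
    have hsep' : ¬ G.Reach F b c := fun h' => hsep (hab.trans h')
    have hsymm (d : V) : ¬ G.Reach F d c → ¬ G.Reach F c d := fun hd h' => hd h'.symm
    refine ⟨by have := h.1; omega, ?_, ?_, fun d => ?_⟩
    · simp [Reach.refl, hab, hab.symm]
    · simp [hsep, hsep', hsymm]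
    · obtain ⟨s, hs, hr⟩ := h.2 d
      rcases Finset.mem_insert.1 hs with rfl | hs
      · exact ⟨{s, b}, by simp, s, by simp, hr⟩
      · exact ⟨{c}, by simp, s, hs, hr⟩

end Partitions

section WeightSums

open Classical

variable [Fintype E] [Fintype V]

/-- The spanning forest polynomial in the edge weights `y`, with the product taken over the
edges in the forest. -/
noncomputable def forestSum (G : Multigraph E V) (y : E → ℚ) (parts : Finset (Finset V)) : ℚ :=
  ∑ F : Finset E, if G.IsSpanningForest parts F then ∏ e ∈ F, y e else 0

/-- The generating function of rooted spanning forests with root set `S`. -/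
noncomputable def rootedForestSum (G : Multigraph E V) (y : E → ℚ) (S : Finset V) : ℚ :=
  ∑ F : Finset E, if G.IsRootedForest S F then ∏ e ∈ F, y e else 0

theorem eval_forestPoly [DecidableEq E] {x : E → ℚ} (hx : ∀ e, x e ≠ 0)
    (parts : Finset (Finset V)) :
    MvPolynomial.eval x (G.forestPoly parts) = (∏ e, x e) * G.forestSum x⁻¹ parts := by
  rw [forestPoly, forestSum, map_sum, Finset.mul_sum]
  refine Finset.sum_congr rfl fun F _ => ?_
  split_ifs
  · have hF : ∏ e ∈ F, x e ≠ 0 := Finset.prod_ne_zero_iff.2 fun e _ => hx e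
    simp only [map_prod, MvPolynomial.eval_X, Pi.inv_apply, Finset.prod_inv_distrib]
    rw [← Finset.prod_mul_prod_compl F, mul_comm (∏ e ∈ F, x e), mul_inv_cancel_right₀ hF]
  · simp

/-- In a forest with two roots, a third vertex belongs to exactly one of the two trees. -/
theorem rootedForestSum_pair [DecidableEq V] (y : E → ℚ) {a b c : V} (hac : a ≠ c) :
    G.rootedForestSum y {a, c} =
      G.forestSum y {({a, b} : Finset V), {c}} + G.forestSum y {({a} : Finset V), {b, c}} := by
  rw [rootedForestSum, forestSum, forestSum, ← Finset.sum_add_distrib]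
  refine Finset.sum_congr rfl fun F _ => ?_
  rw [Finset.pair_comm ({a} : Finset V) {b, c}, Finset.pair_comm b c,
    isSpanningForest_pair_iff hac, isSpanningForest_pair_iff hac.symm,
    Finset.pair_comm c a]
  by_cases h : G.IsRootedForest {a, c} F
  · by_cases hr : G.Reach F a b
    · have : ¬ G.Reach F c b := fun h' =>
        hac (h.eq_of_reach (by simp) (by simp) (hr.trans h'.symm))
      simp [h, hr, this]
    · have : G.Reach F c b := by
        obtain ⟨s, hs, hbs⟩ := h.2 b
        rcases Finset.mem_insert.1 hs with rfl | hs
        · exact absurd hbs.symm hr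
        · exact Finset.mem_singleton.1 hs ▸ hbs.symm
      simp [h, hr, this]
  · simp [h]

theorem forestSum_three_vertex_identity [DecidableEq V]
    (hconn : G.Connected) {y : E → ℚ} (hy : ∀ e, 0 < y e) {u v w : V} (huv : u ≠ v)
    (huw : u ≠ w) (hvw : v ≠ w) :
    G.forestSum y {({u, v, w} : Finset V)} * G.forestSum y {({u} : Finset V), {v}, {w}}
      = G.forestSum y {({u, v} : Finset V), {w}} * G.forestSum y {({u, w} : Finset V), {v}}
        + G.forestSum y {({u, v} : Finset V), {w}} * G.forestSum y {({u} : Finset V), {v, w}}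
        + G.forestSum y {({u, w} : Finset V), {v}} * G.forestSum y {({u} : Finset V), {v, w}} := by
  let t : {a // a ∉ ({u, v, w} : Finset V)} → V := Subtype.val
  have ht : Function.Injective t := Subtype.val_injective
  have hrange (a : V) : a ∈ Set.range t ↔ a ≠ u ∧ a ≠ v ∧ a ≠ w := by simp [t]
  have hdet₃ : ((G.laplacian y).submatrix t t).det = G.rootedForestSum y {u, v, w} :=
    det_laplacian_submatrix y ht fun a => by
      rw [hrange]
      simp only [Finset.mem_insert, Finset.mem_singleton]
      tauto
  have hdet₂ (a b c : V) (habc : ({a, b, c} : Finset V) = {u, v, w}) (hab : a ≠ b)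
      (hac : a ≠ c) :
      ((G.laplacian y).submatrix (Sum.elim t ![a]) (Sum.elim t ![a])).det =
        G.rootedForestSum y {b, c} := by
    have hmem (d : V) : (d = a ∨ d = b ∨ d = c) ↔ (d = u ∨ d = v ∨ d = w) := by
      simpa using Finset.ext_iff.1 habc d
    refine det_laplacian_submatrix y ?_ fun d => ?_
    · refine ht.sumElim (Function.injective_of_subsingleton _) fun i j h => ?_
      have h1 := (hrange _).1 ⟨i, rfl⟩
      have h2 := (hmem a).1 (Or.inl rfl)
      rw [h] at h1
      simp at h1
      tauto
    · have hd := hmem d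
      rw [Set.Sum.elim_range, Set.mem_union, hrange]
      simp only [Finset.mem_insert, Finset.mem_singleton, Matrix.range_cons, Matrix.range_empty,
        Set.union_empty, Set.mem_singleton_iff]
      by_cases hda : d = a
      · subst hda
        tauto
      · tauto
  have hdet₁ : ((G.laplacian y).submatrix (Sum.elim t ![u, v]) (Sum.elim t ![u, v])).det =
      G.rootedForestSum y {w} := by
    refine det_laplacian_submatrix y ?_ fun d => ?_
    · refine ht.sumElim ?_ fun i j h => ?_
      · intro i j
        fin_cases i <;> fin_cases j <;> simp [huv, huv.symm]
      · have h1 := (hrange _).1 ⟨i, rfl⟩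
        rw [h] at h1
        fin_cases j <;> simp at h1
    · rw [Set.Sum.elim_range, Set.mem_union, hrange]
      simp only [Finset.mem_singleton, Matrix.range_cons, Matrix.range_empty,
        Set.union_empty, Set.mem_singleton_iff, Set.mem_union]
      by_cases hdw : d = w
      · subst hdw
        simp [huw.symm, hvw.symm]
      · tauto
  have hne : ((G.laplacian y).submatrix t t).det ≠ 0 :=
    det_laplacian_submatrix_ne_zero hconn hy ht (s := u) fun h => ((hrange u).1 h).1 rfl
  have hsum (a : V) : ∑ i, G.laplacian y a (t i) +
      (G.laplacian y a u + G.laplacian y a v + G.laplacian y a w) = 0 := by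
    have h3 : ∑ b ∈ ({u, v, w} : Finset V), G.laplacian y a b =
        G.laplacian y a u + G.laplacian y a v + G.laplacian y a w := by
      rw [Finset.sum_insert (by simp [huv, huw]), Finset.sum_pair hvw, add_assoc]
    rw [← h3, ← sum_laplacian y a, ← Finset.sum_compl_add_sum ({u, v, w} : Finset V)]
    congr 1
    exact (Finset.sum_subtype _ (fun b => Finset.mem_compl) _).symm
  obtain ⟨P, Q, R, hu, hv, hw, h⟩ :=
    Matrix.principal_minors_triangle (laplacian_transpose y) t u v w hne hsum
  rw [hdet₂ u v w rfl huv huw, rootedForestSum_pair y hvw] at hu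
  rw [hdet₂ v u w (Finset.insert_comm v u {w}) huv.symm hvw,
    rootedForestSum_pair y huw] at hv
  rw [hdet₂ w u v (by rw [Finset.insert_comm w u, Finset.pair_comm w v]) huw.symm hvw.symm,
    rootedForestSum_pair y huv] at hw
  rw [hdet₁, hdet₃] at h
  have h₁ : G.rootedForestSum y {w} = G.forestSum y {({u, v, w} : Finset V)} :=
    Finset.sum_congr rfl fun F _ => by rw [isSpanningForest_singleton_iff]
  have h₃ : G.rootedForestSum y {u, v, w} = G.forestSum y {({u} : Finset V), {v}, {w}} :=
    Finset.sum_congr rfl fun F _ => by rw [isSpanningForest_singletons_iff huv huw hvw]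
  rw [Finset.pair_comm v u, Finset.pair_comm ({v} : Finset V)] at hu
  rw [Finset.pair_comm w v] at hw
  have hP : P = G.forestSum y {({u, v} : Finset V), {w}} := by linarith
  have hQ : Q = G.forestSum y {({u, w} : Finset V), {v}} := by linarith
  have hR : R = G.forestSum y {({u} : Finset V), {v, w}} := by linarith
  rw [← h₁, ← h₃, h, hP, hQ, hR]

end WeightSums

end Multigraph

/-- **Dodgson/forest identity for three marked vertices.**  For any three
distinct vertices `u, v, w` of a connected graph `G`:
`Φ^{{u,v,w}}_G · Φ^{{u},{v},{w}}_G = Φ^{{u,v},{w}}_G · Φ^{{u,w},{v}}_G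
  + Φ^{{u,v},{w}}_G · Φ^{{u},{v,w}}_G + Φ^{{u,w},{v}}_G · Φ^{{u},{v,w}}_G`. -/
theorem forestPoly_three_vertex_identity {E V : Type*} [Fintype E] [DecidableEq E]
    [Fintype V] [DecidableEq V] (G : Multigraph E V) (hconn : G.Connected)
    (u v w : V) (huv : u ≠ v) (huw : u ≠ w) (hvw : v ≠ w) :
    G.forestPoly {({u, v, w} : Finset V)} * G.forestPoly {({u} : Finset V), {v}, {w}}
      = G.forestPoly {({u, v} : Finset V), {w}} * G.forestPoly {({u, w} : Finset V), {v}}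
        + G.forestPoly {({u, v} : Finset V), {w}} * G.forestPoly {({u} : Finset V), {v, w}}
        + G.forestPoly {({u, w} : Finset V), {v}} * G.forestPoly {({u} : Finset V), {v, w}}
      := by
  refine MvPolynomial.funext_set (fun _ => Set.Ioi 0) (fun _ => Set.Ioi_infinite 0) fun x hx => ?_
  have hpos (e : E) : 0 < x e := hx e (Set.mem_univ e)
  have h := Multigraph.forestSum_three_vertex_identity hconn (y := x⁻¹)
    (fun e => inv_pos.2 (hpos e)) huv huw hvw
  simp only [map_mul, map_add, Multigraph.eval_forestPoly fun e => (hpos e).ne']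
  linear_combination (∏ e, x e) ^ 2 * h
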